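/- arXiv:2205.10464 — 5 statements merged into one kernel-verified Lean document; each statement's English description precedes it below -/
import Mathlib

section
/- Let k,p>0 be integers, d = 1 + 2^(-k) the discount factor and ε = 2^(-p) the approximation factor. For every infinite real sequence W bounded by some μ>0, the lower approximation of the discounted sum satisfies 0 ≤ DSum(W,d) − DSLow(W) < d·ε. -/
open Filter Topology

/-- `roundLow r x` is the largest integer multiple of the resolution `r` that is `≤ x`. -/
noncomputable def roundLow (r x : ℝ) : ℝ := ⌊x / r⌋ * r

/-- Lower gap value of a finite real sequence: `gapLow [] = 0`,
`gapLow (V ++ [v]) = roundLow (d * gapLow V + v)`. -/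
noncomputable def gapLow (d r : ℝ) (W : List ℝ) : ℝ :=
  W.foldl (fun g w => roundLow r (d * g + w)) 0

/-- Gap value of a finite real sequence: `gap [] = 0`, `gap (V ++ [v]) = d * gap V + v`. -/
def gap (d : ℝ) (W : List ℝ) : ℝ :=
  W.foldl (fun g w => d * g + w) 0

/-- The `n`-length prefix of an infinite sequence. -/
def pre (W : ℕ → ℝ) (n : ℕ) : List ℝ := (List.range n).map W

theorem roundLow_le {r : ℝ} (hr : 0 < r) (x : ℝ) : roundLow r x ≤ x :=
  (le_div_iff₀ hr).mp (Int.floor_le (x / r))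

theorem sub_roundLow_lt {r : ℝ} (hr : 0 < r) (x : ℝ) : x - roundLow r x < r := by
  have h := (div_lt_iff₀ hr).mp (Int.lt_floor_add_one (x / r))
  unfold roundLow
  linarith

theorem gapLow_pre_succ (d r : ℝ) (W : ℕ → ℝ) (n : ℕ) :
    gapLow d r (pre W (n + 1)) = roundLow r (d * gapLow d r (pre W n) + W n) := by
  simp [gapLow, pre, List.range_succ]

/-- The loss incurred by rounding when the `n`-th letter is read. -/
noncomputable def roundingError (d r : ℝ) (W : ℕ → ℝ) (n : ℕ) : ℝ :=
  d * gapLow d r (pre W n) + W n - gapLow d r (pre W (n + 1))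

theorem roundingError_nonneg {r : ℝ} (hr : 0 < r) (d : ℝ) (W : ℕ → ℝ) (n : ℕ) :
    0 ≤ roundingError d r W n := by
  rw [roundingError, gapLow_pre_succ]
  exact sub_nonneg.mpr (roundLow_le hr _)

theorem roundingError_lt {r : ℝ} (hr : 0 < r) (d : ℝ) (W : ℕ → ℝ) (n : ℕ) :
    roundingError d r W n < r := by
  rw [roundingError, gapLow_pre_succ]
  exact sub_roundLow_lt hr _

/-- Unrolling the recursion for `gapLow`: it is a discounted sum of the letters, each corrected by
its rounding error. -/
theorem gapLow_pre_div_pow_mul {d : ℝ} (hd : d ≠ 0) (r : ℝ) (W : ℕ → ℝ) (n : ℕ) :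
    gapLow d r (pre W n) / d ^ n * d =
      ∑ i ∈ Finset.range n, (W i / d ^ i - roundingError d r W i / d ^ i) := by
  induction n with
  | zero => simp [gapLow, pre]
  | succ n ih =>
    rw [Finset.sum_range_succ, ← ih, roundingError]
    field_simp
    ring

theorem summable_div_pow_of_abs_le {d : ℝ} (hd : 1 < d) {f : ℕ → ℝ} {C : ℝ}
    (hf : ∀ i, |f i| ≤ C) : Summable fun i => f i / d ^ i := by
  have hgeom : Summable fun i : ℕ => C * d⁻¹ ^ i :=
    (summable_geometric_of_lt_one (by positivity) (inv_lt_one_of_one_lt₀ hd)).mul_left C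
  refine hgeom.of_norm_bounded fun i => ?_
  rw [Real.norm_eq_abs, abs_div, abs_of_pos (by positivity : 0 < d ^ i), inv_pow,
    div_eq_mul_inv]
  gcongr
  exact hf i

theorem tsum_const_div_pow {d : ℝ} (hd : 1 < d) (r : ℝ) :
    ∑' i : ℕ, r / d ^ i = d * (r / (d - 1)) := by
  have hd0 : d ≠ 0 := by positivity
  have hd1 : d - 1 ≠ 0 := by linarith
  simp_rw [div_eq_mul_inv r, ← inv_pow]
  rw [tsum_mul_left, tsum_geometric_of_lt_one (by positivity) (inv_lt_one_of_one_lt₀ hd)]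
  have h : 1 - d⁻¹ = (d - 1) / d := by field_simp
  rw [h]
  field_simp

/-- The lower approximation falls short of the discounted sum by the discounted sum of the
rounding errors. -/
theorem tsum_sub_eq_tsum_roundingError {d r L : ℝ} {W : ℕ → ℝ} (hd : 1 < d)
    (hW : Summable fun i => W i / d ^ i)
    (he : Summable fun i => roundingError d r W i / d ^ i)
    (hL : Tendsto (fun n => gapLow d r (pre W n) / d ^ (n - 1)) atTop (𝓝 L)) :
    ∑' i, W i / d ^ i - L = ∑' i, roundingError d r W i / d ^ i := by
  have hd0 : d ≠ 0 := by positivity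
  have hsum := ((hW.hasSum.sub he.hasSum).tendsto_sum_nat).comp (tendsto_add_atTop_nat 1)
  have hlim := hL.comp (tendsto_add_atTop_nat 1)
  have hEq : L = ∑' i, W i / d ^ i - ∑' i, roundingError d r W i / d ^ i := by
    refine tendsto_nhds_unique hlim (hsum.congr fun n => ?_)
    simp only [Function.comp_apply, Nat.add_sub_cancel]
    rw [← gapLow_pre_div_pow_mul hd0]
    field_simp
    ring
  linarith

/-- For integers k,p>0, d = 1+2^(-k), ε = 2^(-p), and every infinite real
sequence W bounded by some μ>0, the lower approximation DSLow(W) of the discounted sum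
satisfies 0 ≤ DSum(W,d) − DSLow(W) < d·ε. -/
theorem stmt_0 (k p : ℕ) (hk : 0 < k) (hp : 0 < p)
    (d ε r : ℝ) (hd : d = 1 + 2 ^ (-(k : ℤ))) (hε : ε = 2 ^ (-(p : ℤ)))
    (hr : r = 2 ^ (-((p : ℤ) + k)))
    (W : ℕ → ℝ) (μ : ℝ) (hμ : 0 < μ) (hW : ∀ i, |W i| ≤ μ)
    (L : ℝ)
    (hL : Tendsto (fun n => gapLow d r (pre W n) / d ^ (n - 1)) atTop (𝓝 L)) :
    0 ≤ (∑' i, W i / d ^ i) - L ∧ (∑' i, W i / d ^ i) - L < d * ε := by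
  have hd1 : 1 < d := by
    rw [hd]
    exact lt_add_of_pos_right _ (by positivity)
  have hr0 : 0 < r := by
    rw [hr]
    positivity
  have hε' : ε = r / (d - 1) := by
    rw [hε, hr, hd, add_sub_cancel_left, neg_add, zpow_add₀ two_ne_zero,
      mul_div_cancel_right₀ _ (by positivity)]
  have he0 := roundingError_nonneg hr0 d W
  have her := roundingError_lt hr0 d W
  have he : Summable fun i => roundingError d r W i / d ^ i :=
    summable_div_pow_of_abs_le hd1 fun i => (abs_of_nonneg (he0 i)).trans_le (her i).le
  rw [tsum_sub_eq_tsum_roundingError hd1 (summable_div_pow_of_abs_le hd1 hW) he hL, hε',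
    ← tsum_const_div_pow hd1]
  refine ⟨tsum_nonneg fun i => div_nonneg (he0 i) (by positivity), ?_⟩
  have hlt : ∀ i, roundingError d r W i / d ^ i < r / d ^ i := fun i =>
    div_lt_div_of_pos_right (her i) (by positivity)
  exact he.tsum_lt_tsum (i := 0) (fun i => (hlt i).le) (hlt 0)
    (summable_div_pow_of_abs_le hd1 fun _ => le_rfl)
end

section
/- Let k,p>0 be integers and d = 1 + 2^(-k). For every infinite real sequence W bounded by some μ>0, the limit lim_{n→∞} gapLow(W[..n]) / d^(n-1) exists (i.e., the sequence n ↦ gapLow(W[..n]) / d^(n-1) converges in ℝ), so DSLow(W) is well defined. -/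
open Filter Topology

theorem abs_roundLow_sub_le {r : ℝ} (hr : 0 < r) (x : ℝ) : |roundLow r x - x| ≤ r := by
  have hx : x / r * r = x := div_mul_cancel₀ x hr.ne'
  have hle := mul_le_mul_of_nonneg_right (Int.floor_le (x / r)) hr.le
  have hlt := mul_lt_mul_of_pos_right (Int.lt_floor_add_one (x / r)) hr
  rw [abs_le]
  unfold roundLow
  constructor <;> linarith

theorem gapLow_pre_zero (d r : ℝ) (W : ℕ → ℝ) : gapLow d r (pre W 0) = 0 := by
  simp [gapLow, pre]

/-- A sequence following `g (n + 1) = d * g n` up to a bounded error, with `1 < d`, converges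
after division by `d ^ n`. -/
theorem exists_tendsto_div_pow_of_abs_sub_le {d C : ℝ} (hd : 1 < d) {g : ℕ → ℝ}
    (hg : ∀ n, |g (n + 1) - d * g n| ≤ C) :
    ∃ L : ℝ, Tendsto (fun n => g n / d ^ n) atTop (𝓝 L) := by
  have hd0 : 0 < d := zero_lt_one.trans hd
  refine cauchySeq_tendsto_of_complete
    (cauchySeq_of_le_geometric d⁻¹ (C / d) (inv_lt_one_of_one_lt₀ hd) fun n => ?_)
  have hdiff : g (n + 1) / d ^ (n + 1) - g n / d ^ n
      = (g (n + 1) - d * g n) / d ^ (n + 1) := by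
    field_simp
    ring
  have hC : C / d * d⁻¹ ^ n = C / d ^ (n + 1) := by
    rw [inv_pow, pow_succ]
    field_simp
  rw [dist_comm, Real.dist_eq, hdiff, hC, abs_div, abs_of_pos (pow_pos hd0 (n + 1))]
  exact div_le_div_of_nonneg_right (hg n) (pow_pos hd0 (n + 1)).le

/-- For integers k,p>0, d = 1+2^(-k), and every infinite real sequence W
bounded by some μ>0, the sequence n ↦ gapLow(W[..n]) / d^(n-1) converges in ℝ. -/
theorem stmt_1 (k p : ℕ) (hk : 0 < k) (hp : 0 < p)
    (d r : ℝ) (hd : d = 1 + 2 ^ (-(k : ℤ)))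
    (hr : r = 2 ^ (-((p : ℤ) + k)))
    (W : ℕ → ℝ) (μ : ℝ) (hμ : 0 < μ) (hW : ∀ i, |W i| ≤ μ) :
    ∃ L : ℝ, Tendsto (fun n => gapLow d r (pre W n) / d ^ (n - 1)) atTop (𝓝 L) := by
  have hd1 : 1 < d := by
    rw [hd]
    exact lt_add_of_pos_right 1 (by positivity)
  have hr0 : 0 < r := by
    rw [hr]
    positivity
  have hd0 : d ≠ 0 := (zero_lt_one.trans hd1).ne'
  obtain ⟨L, hL⟩ := exists_tendsto_div_pow_of_abs_sub_le (C := r + μ) hd1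
    (g := fun n => gapLow d r (pre W n)) fun n => by
      rw [gapLow_pre_succ]
      have hround := abs_le.mp (abs_roundLow_sub_le hr0 (d * gapLow d r (pre W n) + W n))
      have hWn := abs_le.mp (hW n)
      rw [abs_le]
      constructor <;> linarith [hround.1, hround.2, hWn.1, hWn.2]
  refine ⟨d * L, (hL.const_mul d).congr fun n => ?_⟩
  cases n with
  | zero => simp [gapLow_pre_zero]
  | succ n =>
    rw [Nat.add_sub_cancel, pow_succ]
    field_simp
end

section
/- Let k,p>0 be integers, d = 1 + 2^(-k), and μ>0. For every non-empty finite real sequence W bounded by μ, 0 ≤ gap(W) − gapLow(W) < gap(R), where R is the sequence of length |W| all of whose entries equal the resolution r = 2^(-(p+k)). -/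
open Filter Topology

theorem lt_roundLow_add {r : ℝ} (hr : 0 < r) (x : ℝ) : x < roundLow r x + r := by
  have h := (div_lt_iff₀ hr).mp (Int.lt_floor_add_one (x / r))
  rwa [add_one_mul] at h

theorem gap_append_singleton (d : ℝ) (V : List ℝ) (v : ℝ) :
    gap d (V ++ [v]) = d * gap d V + v := by
  simp [gap]

theorem gapLow_append_singleton (d r : ℝ) (V : List ℝ) (v : ℝ) :
    gapLow d r (V ++ [v]) = roundLow r (d * gapLow d r V + v) := by
  simp [gapLow]

theorem gap_replicate_succ (d r : ℝ) (n : ℕ) :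
    gap d (List.replicate (n + 1) r) = d * gap d (List.replicate n r) + r := by
  rw [List.replicate_succ', gap_append_singleton]

theorem gapLow_le_gap {d r : ℝ} (hd : 0 ≤ d) (hr : 0 < r) (W : List ℝ) :
    gapLow d r W ≤ gap d W := by
  induction W using List.reverseRecOn with
  | nil => simp [gap, gapLow]
  | append_singleton V v ih =>
    rw [gap_append_singleton, gapLow_append_singleton]
    exact (roundLow_le hr _).trans (by gcongr)

/-- Appending an entry turns the weak bound on the rounding error into a strict one. -/
theorem gap_sub_gapLow_append_singleton_lt {d r : ℝ} (hd : 0 ≤ d) (hr : 0 < r)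
    {V : List ℝ} (v : ℝ)
    (h : gap d V - gapLow d r V ≤ gap d (List.replicate V.length r)) :
    gap d (V ++ [v]) - gapLow d r (V ++ [v]) <
      gap d (List.replicate (V ++ [v]).length r) := by
  rw [List.length_append, List.length_singleton, gap_replicate_succ, gap_append_singleton,
    gapLow_append_singleton]
  have hround := lt_roundLow_add hr (d * gapLow d r V + v)
  have hmul := mul_le_mul_of_nonneg_left h hd
  linarith

theorem gap_sub_gapLow_le {d r : ℝ} (hd : 0 ≤ d) (hr : 0 < r) (W : List ℝ) :
    gap d W - gapLow d r W ≤ gap d (List.replicate W.length r) := by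
  induction W using List.reverseRecOn with
  | nil => simp [gap, gapLow]
  | append_singleton V v ih => exact (gap_sub_gapLow_append_singleton_lt hd hr v ih).le

/-- For integers k,p>0, d = 1+2^(-k), μ>0, and every non-empty finite real
sequence W bounded by μ, 0 ≤ gap(W) − gapLow(W) < gap(R), where R is the |W|-length
sequence all of whose entries equal r = 2^(-(p+k)). -/
theorem stmt_4 (k p : ℕ) (hk : 0 < k) (hp : 0 < p)
    (d r : ℝ) (hd : d = 1 + 2 ^ (-(k : ℤ)))
    (hr : r = 2 ^ (-((p : ℤ) + k)))
    (μ : ℝ) (hμ : 0 < μ)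
    (W : List ℝ) (hne : W ≠ []) (hW : ∀ w ∈ W, |w| ≤ μ) :
    0 ≤ gap d W - gapLow d r W ∧
      gap d W - gapLow d r W < gap d (List.replicate W.length r) := by
  have hd0 : 0 ≤ d := by rw [hd]; positivity
  have hr0 : 0 < r := by rw [hr]; positivity
  refine ⟨sub_nonneg.mpr (gapLow_le_gap hd0 hr0 W), ?_⟩
  obtain ⟨V, v, rfl⟩ := (List.eq_nil_or_concat' W).resolve_left hne
  exact gap_sub_gapLow_append_singleton_lt hd0 hr0 v (gap_sub_gapLow_le hd0 hr0 V)
end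

section
/- Let k,p>0 be integers, d = 1 + 2^(-k), r = 2^(-(p+k)), μ>0 an integer, and let T_u be the smallest integer with T_u·r ≥ μ·2^k + 2^(-p). For every finite integer-valued sequence A bounded by μ with gapLow(A) ≥ T_u·r, and for every integer a with |a| ≤ μ, the extension satisfies gapLow(A·a) ≥ T_u·r (the upper threshold is absorbing). -/
open Filter Topology

/-- With T_u the smallest integer with T_u·r ≥ μ·2^k + 2^(-p), the upper
threshold is absorbing: if gapLow(A) ≥ T_u·r for a finite integer sequence A bounded by
μ, then gapLow(A·a) ≥ T_u·r for every integer a with |a| ≤ μ. -/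
theorem stmt_10 (k p : ℕ) (hk : 0 < k) (hp : 0 < p)
    (d r : ℝ) (hd : d = 1 + 2 ^ (-(k : ℤ)))
    (hr : r = 2 ^ (-((p : ℤ) + k)))
    (μ : ℤ) (hμ : 0 < μ)
    (Tu : ℤ)
    (hTu : (μ : ℝ) * 2 ^ k + 2 ^ (-(p : ℤ)) ≤ (Tu : ℝ) * r)
    (hTumin : ∀ j : ℤ, (μ : ℝ) * 2 ^ k + 2 ^ (-(p : ℤ)) ≤ (j : ℝ) * r → Tu ≤ j)
    (A : List ℤ) (hA : ∀ x ∈ A, |x| ≤ μ)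
    (hgap : (Tu : ℝ) * r ≤ gapLow d r (A.map (fun z => (z : ℝ))))
    (a : ℤ) (ha : |a| ≤ μ) :
    (Tu : ℝ) * r ≤ gapLow d r ((A ++ [a]).map (fun z => (z : ℝ))) := by
  simp only [List.bind_eq_flatMap, List.pure_def, List.flatMap_append, List.flatMap_singleton,
    List.map_append, List.map_singleton] at hgap ⊢
  rw [gapLow, List.foldl_append, ← gapLow]
  simp only [List.foldl_cons, List.foldl_nil]
  set g := gapLow d r _
  have hr0 : 0 < r := by rw [hr]; positivity
  have hlow : -(μ : ℝ) ≤ a := by exact_mod_cast (abs_le.mp ha).1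
  have hstep : (μ : ℝ) ≤ 2 ^ (-(k : ℤ)) * g := by
    have hμg : (μ : ℝ) * 2 ^ k ≤ g := by
      have : (0 : ℝ) < 2 ^ (-(p : ℤ)) := by positivity
      linarith
    rw [zpow_neg, zpow_natCast, inv_mul_eq_div, le_div_iff₀ (by positivity)]
    exact hμg
  unfold roundLow
  have hfloor : Tu ≤ ⌊(d * g + a) / r⌋ := by
    rw [Int.le_floor, le_div_iff₀ hr0, hd]
    linarith
  gcongr
end

section
/- Let k,p>0 be integers, d = 1 + 2^(-k), r = 2^(-(p+k)), μ>0 an integer, and let T_l be the largest integer with T_l·r ≤ −μ·2^k. For every finite integer-valued sequence A bounded by μ with gapLow(A) ≤ T_l·r, and for every integer a with |a| ≤ μ, the extension satisfies gapLow(A·a) ≤ T_l·r (the lower threshold is absorbing). -/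
open Filter Topology

/-- With T_l the largest integer with T_l·r ≤ −μ·2^k, the lower threshold
is absorbing: if gapLow(A) ≤ T_l·r for a finite integer sequence A bounded by μ, then
gapLow(A·a) ≤ T_l·r for every integer a with |a| ≤ μ. -/
theorem stmt_11 (k p : ℕ) (hk : 0 < k) (hp : 0 < p)
    (d r : ℝ) (hd : d = 1 + 2 ^ (-(k : ℤ)))
    (hr : r = 2 ^ (-((p : ℤ) + k)))
    (μ : ℤ) (hμ : 0 < μ)
    (Tl : ℤ)
    (hTl : (Tl : ℝ) * r ≤ -((μ : ℝ) * 2 ^ k))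
    (hTlmax : ∀ j : ℤ, (j : ℝ) * r ≤ -((μ : ℝ) * 2 ^ k) → j ≤ Tl)
    (A : List ℤ) (hA : ∀ x ∈ A, |x| ≤ μ)
    (hgap : gapLow d r (A.map (fun z => (z : ℝ))) ≤ (Tl : ℝ) * r)
    (a : ℤ) (ha : |a| ≤ μ) :
    gapLow d r ((A ++ [a]).map (fun z => (z : ℝ))) ≤ (Tl : ℝ) * r := by
  have hr0 : 0 < r := by rw [hr]; positivity
  have h_round : ∀ x : ℝ, roundLow r x ≤ x := fun x => by
    rw [roundLow, ← le_div_iff₀ hr0]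
    exact Int.floor_le _
  have ha' : (a : ℝ) ≤ μ := by exact_mod_cast (abs_le.mp ha).2
  have h_step : gapLow d r ((A ++ [a]).map (fun z => (z : ℝ))) =
      roundLow r (d * gapLow d r (A.map (fun z => (z : ℝ))) + a) := by
    simp [gapLow]
  rw [h_step]
  refine (h_round _).trans (le_trans ?_ hgap)
  have h_scaled := mul_le_mul_of_nonneg_right (hgap.trans hTl)
    (by positivity : (0 : ℝ) ≤ 2 ^ (-(k : ℤ)))
  have h_cancel : (2 : ℝ) ^ k * 2 ^ (-(k : ℤ)) = 1 := by
    rw [zpow_neg, zpow_natCast]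
    exact mul_inv_cancel₀ (by positivity)
  rw [neg_mul, mul_assoc, h_cancel] at h_scaled
  rw [hd] at h_scaled ⊢
  linarith
end
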